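/- arXiv:2004.08277 — 3 statements merged into one kernel-verified Lean document; each statement's English description precedes it below -/
import Mathlib

section
/- Let N ≥ 1 and let A and B be N×N positive definite Hermitian complex matrices. Then log(det B) + Re(Tr(B⁻¹ A)) ≥ log(det A) + N, where det A and det B are (positive) real numbers since A and B are positive definite Hermitian. -/
open ComplexOrder
theorem core_aux {N : ℕ} (M : Matrix (Fin N) (Fin N) ℂ) (hM : M.PosDef) :
    Real.log M.det.re + N ≤ M.trace.re := by
  have hd : M.det.re = ∏ i, hM.1.eigenvalues i := by
    rw [hM.1.det_eq_prod_eigenvalues]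
    have : (∏ i, ((hM.1.eigenvalues i : ℝ) : ℂ)) = ((∏ i, hM.1.eigenvalues i : ℝ) : ℂ) := by
      push_cast; rfl
    exact (congrArg Complex.re this).trans (Complex.ofReal_re _)
  have ht : M.trace.re = ∑ i, hM.1.eigenvalues i := by
    rw [hM.1.trace_eq_sum_eigenvalues]
    have : (∑ i, ((hM.1.eigenvalues i : ℝ) : ℂ)) = ((∑ i, hM.1.eigenvalues i : ℝ) : ℂ) := by
      push_cast; rfl
    exact (congrArg Complex.re this).trans (Complex.ofReal_re _)
  rw [hd, ht, Real.log_prod (fun i _ => (hM.eigenvalues_pos i).ne')]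
  have h : ∑ i, Real.log (hM.1.eigenvalues i) ≤ ∑ i, (hM.1.eigenvalues i - 1) :=
    Finset.sum_le_sum fun i _ => Real.log_le_sub_one_of_pos (hM.eigenvalues_pos i)
  rw [Finset.sum_sub_distrib] at h
  simp at h
  linarith

open scoped MatrixOrder in
theorem factor_aux {N : ℕ} (M : Matrix (Fin N) (Fin N) ℂ) (hM : M.PosDef) :
    ∃ C : Matrix (Fin N) (Fin N) ℂ, M = C.conjTranspose * C := by
  obtain ⟨C, hC⟩ := CStarAlgebra.nonneg_iff_eq_star_mul_self.mp hM.posSemidef.nonneg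
  exact ⟨C, hC⟩

/-- For `N ≥ 1` and positive definite Hermitian `A, B ∈ ℂ^{N×N}`,
`log (det B) + Re (Tr (B⁻¹ A)) ≥ log (det A) + N`. -/
theorem logdet_trace_inequality (N : ℕ) (hN : 1 ≤ N)
    (A B : Matrix (Fin N) (Fin N) ℂ) (hA : A.PosDef) (hB : B.PosDef) :
    Real.log B.det.re + (Matrix.trace (B⁻¹ * A)).re ≥
      Real.log A.det.re + N := by
  obtain ⟨C, hC⟩ := factor_aux B⁻¹ hB.inv
  have hBd := hB.det_pos
  have hAd := hA.det_pos
  have hdet : B.det * (C * A * C.conjTranspose).det = A.det := by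
    have h1 : B.det * (B⁻¹).det = 1 := by
      rw [← Matrix.det_mul, Matrix.mul_nonsing_inv _ hBd.ne'.isUnit, Matrix.det_one]
    rw [hC, Matrix.det_mul] at h1
    rw [Matrix.det_mul, Matrix.det_mul]
    linear_combination A.det * h1
  have hu : IsUnit C := by
    rw [Matrix.isUnit_iff_isUnit_det, isUnit_iff_ne_zero]
    intro h0
    apply hAd.ne'
    rw [← hdet]
    simp [Matrix.det_mul, h0]
  have hM : (C * A * C.conjTranspose).PosDef :=
    (Matrix.IsUnit.posDef_star_right_conjugate_iff hu).mpr hA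
  have hMd := hM.det_pos
  have h := core_aux _ hM
  have htr : (C * A * C.conjTranspose).trace = (B⁻¹ * A).trace := by
    rw [hC, Matrix.trace_mul_comm, Matrix.mul_assoc, ← Matrix.mul_assoc]
  rw [htr] at h
  rw [Complex.lt_def] at hBd hMd
  have hre : A.det.re = B.det.re * (C * A * C.conjTranspose).det.re := by
    rw [← hdet, Complex.mul_re, ← hBd.2]
    simp
  rw [hre, Real.log_mul hBd.1.ne' hMd.1.ne']
  linarith
end

section
/- Let N ≥ 1, let d : Fin N → ℝ be monotone nondecreasing with d(i) ≥ 0 for all i, and let g : Fin N → ℝ be monotone nonincreasing with g(i) ≥ 0 for all i. Let D and G be the N×N complex diagonal matrices with diagonal entries d and g respectively. Then for every unitary matrix V ∈ U(N), Re(Tr(V D V† G)) ≥ Σ_{i=1}^N d(i)·g(i) = Tr(D G). -/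
open Matrix

theorem aux_ds (N : ℕ) (d g : Fin N → ℝ) (hd : Monotone d) (hg : Antitone g)
    (M : Matrix (Fin N) (Fin N) ℝ) (hM : M ∈ doublyStochastic ℝ (Fin N)) :
    ∑ i, d i * g i ≤ ∑ i, ∑ j, M i j * (d j * g i) := by
  obtain ⟨w, hw0, hw1, hwM⟩ := exists_eq_sum_perm_of_mem_doublyStochastic hM
  have key : ∑ i, ∑ j, M i j * (d j * g i) =
      ∑ σ : Equiv.Perm (Fin N), w σ * ∑ i, d (σ i) * g i := by
    rw [← hwM]
    simp only [Matrix.sum_apply, Matrix.smul_apply, smul_eq_mul, Finset.sum_mul, Finset.mul_sum]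
    conv_lhs =>
      enter [2, i]
      rw [Finset.sum_comm]
    rw [Finset.sum_comm]
    refine Finset.sum_congr rfl fun σ _ => Finset.sum_congr rfl fun i _ => ?_
    simp [Equiv.Perm.permMatrix, PEquiv.toMatrix_apply]
  rw [key]
  have hav : Antivary d g := hd.antivary hg
  calc ∑ i, d i * g i = ∑ σ : Equiv.Perm (Fin N), w σ * ∑ i, d i * g i := by
        rw [← Finset.sum_mul, hw1, one_mul]
    _ ≤ _ := Finset.sum_le_sum fun σ _ =>
        mul_le_mul_of_nonneg_left (hav.sum_mul_le_sum_comp_perm_mul) (hw0 σ)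

/-- Mirsky-type trace inequality: for diagonal matrices `D` (nondecreasing
nonnegative diagonal) and `G` (nonincreasing nonnegative diagonal), and any
unitary `V`, `Re (Tr (V D V† G)) ≥ ∑ i, d i * g i = Tr (D G)`. -/
theorem mirsky_trace_inequality (N : ℕ) (hN : 1 ≤ N)
    (d g : Fin N → ℝ) (hd : Monotone d) (hd0 : ∀ i, 0 ≤ d i)
    (hg : Antitone g) (hg0 : ∀ i, 0 ≤ g i)
    (D G : Matrix (Fin N) (Fin N) ℂ)
    (hD : D = Matrix.diagonal (fun i => (d i : ℂ)))
    (hG : G = Matrix.diagonal (fun i => (g i : ℂ)))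
    (V : Matrix (Fin N) (Fin N) ℂ) (hV : V ∈ Matrix.unitaryGroup (Fin N) ℂ) :
    (Matrix.trace (V * D * Vᴴ * G)).re ≥ ∑ i, d i * g i ∧
      ∑ i, d i * g i = (Matrix.trace (D * G)).re := by
  subst hD hG
  refine ⟨?_, by simp [Matrix.trace]⟩
  have h1 : V * Vᴴ = 1 := Matrix.mem_unitaryGroup_iff.mp hV
  have h2 : Vᴴ * V = 1 := Matrix.mem_unitaryGroup_iff'.mp hV
  have hM : (Matrix.of fun i j => Complex.normSq (V i j)) ∈ doublyStochastic ℝ (Fin N) := by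
    rw [mem_doublyStochastic_iff_sum]
    refine ⟨fun i j => Complex.normSq_nonneg _, fun i => ?_, fun j => ?_⟩
    · have := congrFun (congrFun h1 i) i
      simp only [Matrix.mul_apply, Matrix.conjTranspose_apply, Matrix.one_apply_eq,
        Complex.star_def, Complex.mul_conj] at this
      exact_mod_cast this
    · have := congrFun (congrFun h2 j) j
      simp only [Matrix.mul_apply, Matrix.conjTranspose_apply, Matrix.one_apply_eq,
        Complex.star_def, ← Complex.normSq_eq_conj_mul_self] at this
      exact_mod_cast this
  refine (aux_ds N d g hd hg _ hM).trans (le_of_eq ?_)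
  simp only [Matrix.trace, Matrix.diag_apply, Matrix.mul_diagonal, Matrix.mul_apply (M := V * _),
    Matrix.conjTranspose_apply, Complex.re_sum, Finset.sum_mul, Matrix.of_apply]
  refine Finset.sum_congr rfl fun i _ => Finset.sum_congr rfl fun j _ => ?_
  have : V i j * (d j : ℂ) * star (V i j) * (g i : ℂ) =
      ((Complex.normSq (V i j) * (d j * g i) : ℝ) : ℂ) := by
    push_cast
    rw [← Complex.mul_conj, Complex.star_def]
    ring
  rw [this, Complex.ofReal_re]
end

section
/- (Core of Proposition 3, fixed noise power.) Let N ≥ 1, 1 ≤ r < N, q > 0, σ² > 0, and let S be an N×N positive semidefinite Hermitian complex matrix admitting an eigendecomposition S = O Γ O† with O unitary and Γ = diag(γ₁,…,γ_N) with γ₁ ≥ γ₂ ≥ … ≥ γ_N ≥ 0. Define Λ̂ = diag(max(γ₁/q − σ², 0), …, max(γ_r/q − σ², 0), 0, …, 0) and R̂ = O Λ̂ O†. Then for every N×N positive semidefinite Hermitian complex matrix R of rank at most r, −q·log det(σ²I + R) − Re(Tr((σ²I + R)⁻¹ S)) ≤ −q·log det(σ²I + R̂) − Re(Tr((σ²I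 + R̂)⁻¹ S)). -/
open Matrix ComplexOrder

noncomputable def phiAux (q σ l s : ℝ) : ℝ := -q * Real.log (σ + l) - s / (σ + l)

lemma phiAux_le (q σ l s : ℝ) (hq : 0 < q) (hσ : 0 < σ) (hl : 0 ≤ l) :
    phiAux q σ l s ≤ phiAux q σ (max (s / q - σ) 0) s := by
  unfold phiAux
  have hx : 0 < σ + l := by linarith
  set x := σ + l with hxdef
  obtain ⟨y, hy⟩ : ∃ y, y = σ + max (s / q - σ) 0 := ⟨_, rfl⟩
  rw [← hy]
  have hyσ : σ ≤ y := by rw [hy]; linarith [le_max_right (s / q - σ) 0]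
  have hy0 : 0 < y := by linarith
  have h1 : Real.log (y / x) ≤ y / x - 1 := Real.log_le_sub_one_of_pos (by positivity)
  rw [Real.log_div hy0.ne' hx.ne'] at h1
  have h2 : (q * y - s) / x ≤ (q * y - s) / y := by
    rcases le_total (s / q - σ) 0 with h | h
    · have e : y = σ := by rw [hy, max_eq_right h, add_zero]
      have h3 : s / q ≤ y := by linarith
      rw [div_le_iff₀ hq] at h3
      apply div_le_div_of_nonneg_left _ hy0 (by linarith)
      linarith
    · have e : y = s / q := by rw [hy, max_eq_left h]; ring
      have : q * y - s = 0 := by rw [e]; field_simp; ring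
      rw [this]; simp
  have h3 : (q * y - s) / x = q * (y / x) - s / x := by ring
  have h4 : (q * y - s) / y = q - s / y := by field_simp
  rw [h3, h4] at h2
  nlinarith [mul_le_mul_of_nonneg_left h1 hq.le]

noncomputable def hAux (q σ s : ℝ) : ℝ :=
  phiAux q σ (max (s / q - σ) 0) s - phiAux q σ 0 s

lemma hAux_nonneg (q σ s : ℝ) (hq : 0 < q) (hσ : 0 < σ) : 0 ≤ hAux q σ s :=
  sub_nonneg.2 (phiAux_le q σ 0 s hq hσ le_rfl)

lemma hAux_mono (q σ : ℝ) (hq : 0 < q) (hσ : 0 < σ) : Monotone (hAux q σ) := by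
  intro s t hst
  have h1 := phiAux_le q σ (max (s / q - σ) 0) t hq hσ (le_max_right _ _)
  unfold hAux
  generalize hl : max (s / q - σ) 0 = l at *
  have hl0 : 0 ≤ l := by rw [← hl]; exact le_max_right _ _
  have h2 : phiAux q σ l s - phiAux q σ 0 s ≤ phiAux q σ l t - phiAux q σ 0 t := by
    unfold phiAux
    have h3 : (t - s) / (σ + l) ≤ (t - s) / (σ + 0) :=
      div_le_div_of_nonneg_left (by linarith) (by linarith) (by linarith)
    rw [sub_div, sub_div] at h3
    linarith
  linarith

lemma weight_le {N r : ℕ} (hrN : r < N) (a c : Fin N → ℝ) (ha : Antitone a)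
    (ha0 : ∀ i, 0 ≤ a i) (hc0 : ∀ i, 0 ≤ c i) (hc1 : ∀ i, c i ≤ 1) (hc : ∑ i, c i ≤ r) :
    ∑ i, c i * a i ≤ ∑ i : Fin N, if (i : ℕ) < r then a i else 0 := by
  set t := a ⟨r, hrN⟩ with ht
  have h1 : ∀ i : Fin N, c i * a i ≤
      (if (i : ℕ) < r then a i else 0) + t * (c i - if (i : ℕ) < r then 1 else 0) := by
    intro i
    split_ifs with h
    · have : t ≤ a i := ha (Fin.mk_le_mk.2 h.le : i ≤ ⟨r, hrN⟩)
      nlinarith [hc1 i]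
    · have : a i ≤ t := ha (Fin.mk_le_mk.2 (not_lt.1 h) : (⟨r, hrN⟩ : Fin N) ≤ i)
      nlinarith [hc0 i]
  have h2 : ∑ i : Fin N, (if (i : ℕ) < r then (1 : ℝ) else 0) = r := by
    rw [Fin.sum_univ_eq_sum_range (fun i => if i < r then (1 : ℝ) else 0) N,
      ← Finset.sum_filter]
    have : (Finset.range N).filter (fun i => i < r) = Finset.range r := by
      ext i; simp; omega
    rw [this]; simp
  calc _ ≤ _ := Finset.sum_le_sum fun i _ => h1 i
    _ = (∑ i : Fin N, if (i : ℕ) < r then a i else 0) + t * (∑ i, c i - r) := by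
      rw [Finset.sum_add_distrib, ← Finset.mul_sum, Finset.sum_sub_distrib, h2]
    _ ≤ _ := by nlinarith [ha0 ⟨r, hrN⟩]

lemma obj_eq {N : ℕ} (q σ : ℝ) (hσ : 0 < σ) (O U : Matrix (Fin N) (Fin N) ℂ)
    (hU : U ∈ Matrix.unitaryGroup (Fin N) ℂ)
    (γ d : Fin N → ℝ) (hd : ∀ j, 0 ≤ d j)
    (S R : Matrix (Fin N) (Fin N) ℂ)
    (hS : S = O * Matrix.diagonal (fun m => (γ m : ℂ)) * Oᴴ)
    (hR : R = U * Matrix.diagonal (fun m => (d m : ℂ)) * Uᴴ) :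
    -q * Real.log ((σ : ℂ) • (1 : Matrix (Fin N) (Fin N) ℂ) + R).det.re -
        (Matrix.trace (((σ : ℂ) • (1 : Matrix (Fin N) (Fin N) ℂ) + R)⁻¹ * S)).re =
    ∑ j, (-q * Real.log (σ + d j) - ∑ i, Complex.normSq ((Oᴴ * U) i j) * (γ i / (σ + d j))) := by
  have hU1 : U * Uᴴ = 1 := Matrix.mem_unitaryGroup_iff.1 hU
  have hU2 : Uᴴ * U = 1 := Matrix.mem_unitaryGroup_iff'.1 hU
  have hpos : ∀ j, 0 < σ + d j := fun j => by linarith [hd j]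
  have hM : (σ : ℂ) • (1 : Matrix (Fin N) (Fin N) ℂ) + R =
      U * Matrix.diagonal (fun m => ((σ + d m : ℝ) : ℂ)) * Uᴴ := by
    have : Matrix.diagonal (fun m => ((σ + d m : ℝ) : ℂ)) =
      (σ : ℂ) • (1 : Matrix (Fin N) (Fin N) ℂ) + Matrix.diagonal (fun m => (d m : ℂ)) := by
      rw [Matrix.smul_one_eq_diagonal, Matrix.diagonal_add]; simp
    rw [this, mul_add, add_mul, hR]
    simp [hU1]
  have hdet : ((σ : ℂ) • (1 : Matrix (Fin N) (Fin N) ℂ) + R).det = ((∏ j, (σ + d j) : ℝ) : ℂ) := by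
    rw [hM, Matrix.det_mul, Matrix.det_mul, mul_right_comm, ← Matrix.det_mul, hU1,
      Matrix.det_one, one_mul, Matrix.det_diagonal]
    push_cast; rfl
  have hinv : ((σ : ℂ) • (1 : Matrix (Fin N) (Fin N) ℂ) + R)⁻¹ =
      U * Matrix.diagonal (fun m => (((σ + d m)⁻¹ : ℝ) : ℂ)) * Uᴴ := by
    apply Matrix.inv_eq_right_inv
    rw [hM]
    have : Matrix.diagonal (fun m => ((σ + d m : ℝ) : ℂ)) *
        Matrix.diagonal (fun m => (((σ + d m)⁻¹ : ℝ) : ℂ)) = 1 := by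
      rw [Matrix.diagonal_mul_diagonal, ← Matrix.diagonal_one]
      congr 1; ext m
      rw [← Complex.ofReal_mul, mul_inv_cancel₀ (hpos m).ne']; simp
    calc _ = U * (Matrix.diagonal (fun m => ((σ + d m : ℝ) : ℂ)) * (Uᴴ * U) *
        Matrix.diagonal (fun m => (((σ + d m)⁻¹ : ℝ) : ℂ))) * Uᴴ := by
          simp only [Matrix.mul_assoc]
      _ = 1 := by rw [hU2, Matrix.mul_one, this, Matrix.mul_one, hU1]
  have htr : (Matrix.trace (((σ : ℂ) • (1 : Matrix (Fin N) (Fin N) ℂ) + R)⁻¹ * S)) =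
      ((∑ j, ∑ i, Complex.normSq ((Oᴴ * U) i j) * (γ i / (σ + d j)) : ℝ) : ℂ) := by
    rw [hinv, hS]
    have : Matrix.trace (U * Matrix.diagonal (fun m => (((σ + d m)⁻¹ : ℝ) : ℂ)) * Uᴴ *
        (O * Matrix.diagonal (fun m => (γ m : ℂ)) * Oᴴ)) =
        Matrix.trace ((Matrix.diagonal (fun m => (((σ + d m)⁻¹ : ℝ) : ℂ)) * (Oᴴ * U)ᴴ) *
          (Matrix.diagonal (fun m => (γ m : ℂ)) * (Oᴴ * U))) := by
      rw [Matrix.conjTranspose_mul, Matrix.conjTranspose_conjTranspose]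
      simp only [Matrix.mul_assoc]
      rw [Matrix.trace_mul_comm]
      simp only [Matrix.mul_assoc]
    rw [this, Matrix.trace]
    push_cast
    refine Finset.sum_congr rfl fun j _ => ?_
    rw [Matrix.diag_apply, Matrix.mul_apply]
    refine Finset.sum_congr rfl fun i _ => ?_
    rw [Matrix.diagonal_mul, Matrix.diagonal_mul, Matrix.conjTranspose_apply,
      Complex.normSq_eq_conj_mul_self]
    simp only [Complex.star_def]
    push_cast
    ring
  rw [hdet, htr, Complex.ofReal_re, Complex.ofReal_re, Real.log_prod (fun j _ => (hpos j).ne'),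
    Finset.mul_sum, ← Finset.sum_sub_distrib]

lemma unit_col {N : ℕ} (W : Matrix (Fin N) (Fin N) ℂ) (h : Wᴴ * W = 1) (j : Fin N) :
    ∑ i, Complex.normSq (W i j) = 1 := by
  have := congrFun (congrFun h j) j
  rw [Matrix.mul_apply, Matrix.one_apply_eq] at this
  have h2 : ((∑ i, Complex.normSq (W i j) : ℝ) : ℂ) = 1 := by
    rw [← this]; push_cast
    refine Finset.sum_congr rfl fun i _ => ?_
    rw [Complex.normSq_eq_conj_mul_self, Matrix.conjTranspose_apply]; rfl
  exact_mod_cast h2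

lemma unit_row {N : ℕ} (W : Matrix (Fin N) (Fin N) ℂ) (h : W * Wᴴ = 1) (i : Fin N) :
    ∑ j, Complex.normSq (W i j) = 1 := by
  have := unit_col Wᴴ (by simpa using h) i
  simpa [Matrix.conjTranspose_apply] using this

lemma scalar_core {N r : ℕ} (hrN : r < N) (q σ : ℝ) (hq : 0 < q) (hσ : 0 < σ)
    (γ d : Fin N → ℝ) (hγ : Antitone γ) (hd : ∀ j, 0 ≤ d j)
    (hcard : (Finset.univ.filter (fun j => d j ≠ 0)).card ≤ r)
    (P : Fin N → Fin N → ℝ) (hP : ∀ i j, 0 ≤ P i j)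
    (hcol : ∀ j, ∑ i, P i j = 1) (hrow : ∀ i, ∑ j, P i j = 1) :
    ∑ j, (-q * Real.log (σ + d j) - ∑ i, P i j * (γ i / (σ + d j))) ≤
    ∑ i : Fin N, phiAux q σ (if (i : ℕ) < r then max (γ i / q - σ) 0 else 0) (γ i) := by
  set J := Finset.univ.filter (fun j => d j ≠ 0) with hJ
  have e1 : ∀ j, (-q * Real.log (σ + d j) - ∑ i, P i j * (γ i / (σ + d j))) =
      ∑ i, P i j * phiAux q σ (d j) (γ i) := by
    intro j
    simp only [phiAux, mul_sub, Finset.sum_sub_distrib]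
    rw [← Finset.sum_mul, hcol, one_mul]
  have e2 : ∀ i j, P i j * phiAux q σ (d j) (γ i) ≤
      P i j * phiAux q σ 0 (γ i) + (if d j ≠ 0 then P i j else 0) * hAux q σ (γ i) := by
    intro i j
    by_cases h : d j = 0
    · simp [h]
    · rw [if_pos h, ← mul_add]
      apply mul_le_mul_of_nonneg_left _ (hP i j)
      unfold hAux
      linarith [phiAux_le q σ (d j) (γ i) hq hσ (hd j)]
  have e3 : ∑ i, (∑ j, if d j ≠ 0 then P i j else 0) * hAux q σ (γ i) ≤
      ∑ i : Fin N, if (i : ℕ) < r then hAux q σ (γ i) else 0 := by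
    apply weight_le hrN (fun i => hAux q σ (γ i)) (fun i => ∑ j, if d j ≠ 0 then P i j else 0)
    · exact fun i j hij => hAux_mono q σ hq hσ (hγ hij)
    · exact fun i => hAux_nonneg _ _ _ hq hσ
    · exact fun i => Finset.sum_nonneg fun j _ => by split_ifs; exacts [hP i j, le_rfl]
    · intro i
      rw [← hrow i]
      exact Finset.sum_le_sum fun j _ => by split_ifs; exacts [le_rfl, hP i j]
    · rw [Finset.sum_comm]
      have : ∀ j, (∑ i, if d j ≠ 0 then P i j else 0) = if d j ≠ 0 then 1 else 0 := by
        intro j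
        split_ifs
        · exact hcol j
        · simp
      simp only [this]
      rw [Finset.sum_boole]
      exact_mod_cast hcard
  simp only [e1]
  rw [Finset.sum_comm]
  calc _ ≤ ∑ i, ∑ j, (P i j * phiAux q σ 0 (γ i) +
          (if d j ≠ 0 then P i j else 0) * hAux q σ (γ i)) :=
        Finset.sum_le_sum fun i _ => Finset.sum_le_sum fun j _ => e2 i j
    _ = ∑ i, phiAux q σ 0 (γ i) +
        ∑ i, (∑ j, if d j ≠ 0 then P i j else 0) * hAux q σ (γ i) := by
      rw [← Finset.sum_add_distrib]
      refine Finset.sum_congr rfl fun i _ => ?_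
      rw [Finset.sum_add_distrib, ← Finset.sum_mul, ← Finset.sum_mul, hrow, one_mul]
    _ ≤ ∑ i, phiAux q σ 0 (γ i) + ∑ i : Fin N, (if (i : ℕ) < r then hAux q σ (γ i) else 0) := by
      linarith
    _ = _ := by
      rw [← Finset.sum_add_distrib]
      refine Finset.sum_congr rfl fun i _ => ?_
      split_ifs
      · unfold hAux; ring
      · ring

/-- Core of Proposition 3 (fixed noise power): among positive semidefinite
clutter components of rank at most `r`, the matrix `R̂` obtained by keeping the
top-`r` eigenvectors of `S` and thresholding the scaled eigenvalues maximizes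
`−q log det(σ²I + R) − Tr((σ²I + R)⁻¹ S)`. -/
theorem prop3_core_fixed_noise (N r : ℕ) (hr1 : 1 ≤ r) (hrN : r < N)
    (q σsq : ℝ) (hq : 0 < q) (hσ : 0 < σsq)
    (S : Matrix (Fin N) (Fin N) ℂ) (hS : S.PosSemidef)
    (O : Matrix (Fin N) (Fin N) ℂ) (hO : O ∈ Matrix.unitaryGroup (Fin N) ℂ)
    (γ : Fin N → ℝ) (hγsorted : Antitone γ) (hγ0 : ∀ m, 0 ≤ γ m)
    (hdecomp : S = O * Matrix.diagonal (fun m => (γ m : ℂ)) * Oᴴ)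
    (Rhat : Matrix (Fin N) (Fin N) ℂ)
    (hRhat : Rhat = O * Matrix.diagonal
      (fun m : Fin N =>
        ((if (m : ℕ) < r then max (γ m / q - σsq) 0 else 0 : ℝ) : ℂ)) * Oᴴ)
    (R : Matrix (Fin N) (Fin N) ℂ) (hRpsd : R.PosSemidef)
    (hRrank : R.rank ≤ r) :
    -q * Real.log ((σsq : ℂ) • (1 : Matrix (Fin N) (Fin N) ℂ) + R).det.re -
        (Matrix.trace (((σsq : ℂ) • (1 : Matrix (Fin N) (Fin N) ℂ) + R)⁻¹ * S)).re ≤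
      -q * Real.log ((σsq : ℂ) • (1 : Matrix (Fin N) (Fin N) ℂ) + Rhat).det.re -
        (Matrix.trace (((σsq : ℂ) • (1 : Matrix (Fin N) (Fin N) ℂ) + Rhat)⁻¹ * S)).re := by
  have hO1 : O * Oᴴ = 1 := Matrix.mem_unitaryGroup_iff.1 hO
  have hO2 : Oᴴ * O = 1 := Matrix.mem_unitaryGroup_iff'.1 hO
  have hH := hRpsd.isHermitian
  obtain ⟨U, hU⟩ : ∃ U, U = (hH.eigenvectorUnitary : Matrix (Fin N) (Fin N) ℂ) := ⟨_, rfl⟩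
  have hUm : U ∈ Matrix.unitaryGroup (Fin N) ℂ := hU ▸ hH.eigenvectorUnitary.2
  have hU1 : U * Uᴴ = 1 := Matrix.mem_unitaryGroup_iff.1 hUm
  have hU2 : Uᴴ * U = 1 := Matrix.mem_unitaryGroup_iff'.1 hUm
  have hRd : R = U * Matrix.diagonal (fun m => (hH.eigenvalues m : ℂ)) * Uᴴ := by
    have := hH.spectral_theorem
    rw [Unitary.conjStarAlgAut_apply] at this
    rw [hU]
    exact this
  have hd : ∀ j, 0 ≤ hH.eigenvalues j := hRpsd.eigenvalues_nonneg
  have hcard : (Finset.univ.filter (fun j => hH.eigenvalues j ≠ 0)).card ≤ r := by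
    rw [hH.rank_eq_card_non_zero_eigs, Fintype.card_subtype] at hRrank
    exact hRrank
  rw [obj_eq q σsq hσ O U hUm γ _ hd S R hdecomp hRd,
    obj_eq q σsq hσ O O hO γ _ (fun j => by split_ifs; exacts [le_max_right _ _, le_rfl])
      S Rhat hdecomp hRhat]
  have key := scalar_core hrN q σsq hq hσ γ _ hγsorted hd hcard
    (fun i j => Complex.normSq ((Oᴴ * U) i j)) (fun i j => Complex.normSq_nonneg _)
    (unit_col _ (by
      rw [Matrix.conjTranspose_mul, Matrix.conjTranspose_conjTranspose, Matrix.mul_assoc,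
        ← Matrix.mul_assoc O, hO1, Matrix.one_mul, hU2]))
    (unit_row _ (by
      rw [Matrix.conjTranspose_mul, Matrix.conjTranspose_conjTranspose, Matrix.mul_assoc,
        ← Matrix.mul_assoc U, hU1, Matrix.one_mul, hO2]))
  refine key.trans (le_of_eq ?_)
  refine Finset.sum_congr rfl fun j _ => ?_
  unfold phiAux
  rw [hO2, Finset.sum_eq_single j]
  · simp
  · intro i _ hij
    simp [Matrix.one_apply_ne hij]
  · simp
end
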